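/- For every y ∈ ℝⁿ there exists δ > 0 such that for all y' ∈ ℝⁿ with ‖y' − y‖ < δ, every signed permutation matrix π satisfying πy' = |y'|^↓ also satisfies πy = |y|^↓; in other words, Π^s(y') ⊆ Π^s(y) for all y' in a neighborhood of y. -/

import Mathlib

open Matrix

/-- `absDown x` is the vector of the absolute values of the entries of `x`
arranged in non-increasing order, i.e. `|x|^↓`. -/
noncomputable def absDown {n : ℕ} (x : Fin n → ℝ) : Fin n → ℝ :=
  fun i => |x (Tuple.sort (fun k => -|x k|) i)|

/-- The decreasing weighted sorted ℓ₁ (DWSL1) function `κ_λ(x) = ∑ λ_i |x|_i^↓`. -/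
noncomputable def kappa {n : ℕ} (lam x : Fin n → ℝ) : ℝ :=
  ∑ i, lam i * absDown x i

/-- A signed permutation matrix: exactly one nonzero entry in each row and
each column, and every entry is `0`, `1` or `-1`. -/
def IsSignedPerm {n : ℕ} (π : Matrix (Fin n) (Fin n) ℝ) : Prop :=
  (∀ i, ∃! j, π i j ≠ 0) ∧ (∀ j, ∃! i, π i j ≠ 0) ∧
    ∀ i j, π i j = 0 ∨ π i j = 1 ∨ π i j = -1

/-- The matrix `B` with `(Bx)_i = x_i - x_{i+1}` for `i < n-1` and `(Bx)_{n-1} = x_{n-1}`. -/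
def Bmat (n : ℕ) : Matrix (Fin n) (Fin n) ℝ :=
  Matrix.of fun i j => if j = i then 1 else if (j : ℕ) = (i : ℕ) + 1 then -1 else 0

/-- `B_Γ`: the submatrix of `B` consisting of the rows indexed by `Γ`. -/
def Brows {n : ℕ} (Γ : Finset (Fin n)) : Matrix {i // i ∈ Γ} (Fin n) ℝ :=
  Matrix.of fun i j => Bmat n i.1 j

/-- `P = Iₙ - B_Γᵀ (B_Γ B_Γᵀ)⁻¹ B_Γ`. -/
noncomputable def Pmat {n : ℕ} (Γ : Finset (Fin n)) : Matrix (Fin n) (Fin n) ℝ :=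
  1 - (Brows Γ)ᵀ * (Brows Γ * (Brows Γ)ᵀ)⁻¹ * Brows Γ

/-- The Euclidean norm on `Fin n → ℝ`. -/
noncomputable def eucNorm {n : ℕ} (x : Fin n → ℝ) : ℝ := Real.sqrt (∑ i, (x i) ^ 2)

/-- Membership in the set `C_λ = {z : ∑_{j ≤ i} |z|_j^↓ ≤ ∑_{j ≤ i} λ_j for all i}`. -/
def memC {n : ℕ} (lam z : Fin n → ℝ) : Prop :=
  ∀ i : Fin n, ∑ j ∈ Finset.Iic i, absDown z j ≤ ∑ j ∈ Finset.Iic i, lam j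

/-- Up to sign, the action of a signed permutation matrix is the action of a permutation. -/
theorem IsSignedPerm.exists_perm_abs_mulVec {n : ℕ} {π : Matrix (Fin n) (Fin n) ℝ}
    (hπ : IsSignedPerm π) :
    ∃ σ : Equiv.Perm (Fin n), ∀ (x : Fin n → ℝ) (i : Fin n), |(π *ᵥ x) i| = |x (σ i)| := by
  obtain ⟨hrow, hcol, hval⟩ := hπ
  choose σ hσ hσ_unique using hrow
  have hinj : Function.Injective σ := fun i i' h =>
    (hcol (σ i)).unique (hσ i) (h ▸ hσ i')
  refine ⟨Equiv.ofBijective σ (Finite.injective_iff_bijective.mp hinj), fun x i => ?_⟩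
  have hsum : (π *ᵥ x) i = π i (σ i) * x (σ i) := by
    refine Finset.sum_eq_single (σ i) (fun j _ hj => ?_)
      fun h => absurd (Finset.mem_univ _) h
    have : π i j = 0 := by
      by_contra h
      exact hj (hσ_unique i j h)
    simp [this]
  have habs : |π i (σ i)| = 1 := by
    rcases hval i (σ i) with h | h | h
    · exact absurd h (hσ i)
    · simp [h]
    · simp [h]
  simp [hsum, abs_mul, habs]

theorem absDown_nonneg {n : ℕ} (x : Fin n → ℝ) : 0 ≤ absDown x :=
  fun _ => abs_nonneg _

theorem antitone_absDown {n : ℕ} (x : Fin n → ℝ) : Antitone (absDown x) := fun i j hij => by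
  have h := Tuple.monotone_sort (fun k => -|x k|) hij
  simpa [absDown] using h

/-- A signed permutation matrix sorts `x` exactly when the result is nonnegative and
non-increasing. -/
theorem IsSignedPerm.mulVec_eq_absDown_iff {n : ℕ} {π : Matrix (Fin n) (Fin n) ℝ}
    (hπ : IsSignedPerm π) (x : Fin n → ℝ) :
    π *ᵥ x = absDown x ↔ 0 ≤ π *ᵥ x ∧ Antitone (π *ᵥ x) := by
  refine ⟨fun h => h ▸ ⟨absDown_nonneg x, antitone_absDown x⟩, fun ⟨hnonneg, hanti⟩ => ?_⟩
  obtain ⟨σ, hσ⟩ := hπ.exists_perm_abs_mulVec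
  have hval : ∀ i, (π *ᵥ x) i = |x (σ i)| := fun i => by
    rw [← hσ, abs_of_nonneg (hnonneg i)]
  have hmono : Monotone ((fun k => -|x k|) ∘ σ) := fun i j hij => by
    simpa [← hval] using hanti hij
  ext i
  have h := congrFun (Tuple.comp_sort_eq_comp_iff_monotone.mpr hmono) i
  rw [hval]
  simpa [absDown] using h

theorem IsSignedPerm.isClosed_setOf_mulVec_eq_absDown {n : ℕ} {π : Matrix (Fin n) (Fin n) ℝ}
    (hπ : IsSignedPerm π) : IsClosed {x : Fin n → ℝ | π *ᵥ x = absDown x} := by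
  simp only [hπ.mulVec_eq_absDown_iff]
  have hcont : Continuous fun x : Fin n → ℝ => π *ᵥ x := by fun_prop
  exact (isClosed_le continuous_const hcont).inter (isClosed_antitone.preimage hcont)

theorem finite_setOf_isSignedPerm (n : ℕ) :
    {π : Matrix (Fin n) (Fin n) ℝ | IsSignedPerm π}.Finite := by
  have hentries : ({0, 1, -1} : Set ℝ).Finite := Set.toFinite _
  refine (Set.Finite.pi' fun _ : Fin n => Set.Finite.pi' fun _ : Fin n => hentries).subset ?_
  exact fun π hπ i j => hπ.2.2 i j

theorem abs_apply_le_eucNorm {n : ℕ} (x : Fin n → ℝ) (i : Fin n) : |x i| ≤ eucNorm x :=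
  Real.abs_le_sqrt <|
    Finset.single_le_sum (f := fun i => x i ^ 2) (fun _ _ => sq_nonneg _) (Finset.mem_univ i)

theorem norm_le_eucNorm {n : ℕ} (x : Fin n → ℝ) : ‖x‖ ≤ eucNorm x :=
  (pi_norm_le_iff_of_nonneg (Real.sqrt_nonneg _)).mpr (abs_apply_le_eucNorm x)

/-- Local stability of the set of sorting signed permutations:
`Π^s(y') ⊆ Π^s(y)` for all `y'` near `y`. -/
theorem stmt6 {n : ℕ} (y : Fin n → ℝ) :
    ∃ δ > 0, ∀ y' : Fin n → ℝ, eucNorm (y' - y) < δ →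
      ∀ π : Matrix (Fin n) (Fin n) ℝ, IsSignedPerm π →
        π.mulVec y' = absDown y' → π.mulVec y = absDown y := by
  have hnear : ∀ᶠ y' in nhds y, ∀ π ∈ {π : Matrix (Fin n) (Fin n) ℝ | IsSignedPerm π},
      π *ᵥ y' = absDown y' → π *ᵥ y = absDown y := by
    refine (finite_setOf_isSignedPerm n).eventually_all.mpr fun π hπ => ?_
    by_cases hy : π *ᵥ y = absDown y
    · exact Filter.Eventually.of_forall fun _ _ => hy
    · filter_upwards [hπ.isClosed_setOf_mulVec_eq_absDown.isOpen_compl.mem_nhds hy] with y' hy' h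
      exact absurd h hy'
  obtain ⟨δ, hδ, hball⟩ := Metric.eventually_nhds_iff.mp hnear
  refine ⟨δ, hδ, fun y' hy' π hπ => hball ?_ π hπ⟩
  exact (dist_eq_norm y' y).trans_le (norm_le_eucNorm _) |>.trans_lt hy'
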